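/- arXiv:2406.11517 — 2 statements merged into one kernel-verified Lean document; each statement's English description precedes it below -/
import Mathlib

section
/- (PSW expected-risk identity.) Let C, S, Y be random variables on a probability space (Ω, P) taking values in finite types 𝒞, 𝒮, 𝒴, and assume positivity: P(C = c, S = s) > 0 for every c ∈ 𝒞 and s ∈ 𝒮. Let g : 𝒞 × 𝒴 → ℝ be any function and define the propensity score π(c, s) = P(C = c | S = s). Then E[ g(C, Y) / π(C, S) ] = Σ_{c ∈ 𝒞} Σ_{y ∈ 𝒴} g(c, y) · Σ_{s ∈ 𝒮} P(Y = y | C = c, S = s) · P(S = s). -/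
open MeasureTheory ProbabilityTheory

/-- The integral of a function of a random variable with finitely many values is the finite
sum of its values weighted by their probabilities. -/
theorem integral_comp_eq_sum_of_fintype {Ω α : Type*} [MeasurableSpace Ω] (P : Measure Ω)
    [IsFiniteMeasure P] [Fintype α] [MeasurableSpace α] [MeasurableSingletonClass α]
    {X : Ω → α} (hX : Measurable X) (f : α → ℝ) :
    ∫ ω, f (X ω) ∂P = ∑ a, (P {ω | X ω = a}).toReal * f a := by
  have hf : Integrable f (P.map X) := Integrable.of_finite
  rw [← integral_map hX.aemeasurable hf.aestronglyMeasurable, integral_fintype hf]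
  refine Finset.sum_congr rfl fun a _ => ?_
  rw [measureReal_def, Measure.map_apply hX (measurableSet_singleton a), smul_eq_mul]
  rfl

/-- PSW expected-risk identity: under positivity `P(C = c, S = s) > 0` for all `c, s`,
for any loss `g : 𝒞 × 𝒴 → ℝ` and propensity score `π(c, s) = P(C = c ∣ S = s)`,
`E[g(C, Y)/π(C, S)] = ∑_c ∑_y g(c, y) · ∑_s P(Y = y ∣ C = c, S = s) · P(S = s)`,
i.e. the PSW expectation under the observational distribution equals the expectation under
the backdoor-adjusted (post-intervention) distribution. -/
theorem stmt5 {Ω : Type*} [MeasurableSpace Ω] (P : Measure Ω) [IsProbabilityMeasure P]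
    {𝒞 𝒮 𝒴 : Type*} [Fintype 𝒞] [Fintype 𝒮] [Fintype 𝒴]
    [MeasurableSpace 𝒞] [MeasurableSingletonClass 𝒞]
    [MeasurableSpace 𝒮] [MeasurableSingletonClass 𝒮]
    [MeasurableSpace 𝒴] [MeasurableSingletonClass 𝒴]
    (C : Ω → 𝒞) (S : Ω → 𝒮) (Y : Ω → 𝒴)
    (hC : Measurable C) (hS : Measurable S) (hY : Measurable Y)
    (hpos : ∀ (c : 𝒞) (s : 𝒮), 0 < P {ω | C ω = c ∧ S ω = s})
    (g : 𝒞 × 𝒴 → ℝ)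
    (π : 𝒞 → 𝒮 → ℝ)
    (hπ : ∀ (c : 𝒞) (s : 𝒮),
      π c s = (P {ω | C ω = c ∧ S ω = s}).toReal / (P {ω | S ω = s}).toReal) :
    ∫ ω, g (C ω, Y ω) / π (C ω) (S ω) ∂P
      = ∑ c : 𝒞, ∑ y : 𝒴, g (c, y)
          * ∑ s : 𝒮,
              ((P {ω | Y ω = y ∧ C ω = c ∧ S ω = s}).toReal
                  / (P {ω | C ω = c ∧ S ω = s}).toReal)
                * (P {ω | S ω = s}).toReal := by
  have hX : Measurable fun ω => (C ω, Y ω, S ω) := hC.prodMk (hY.prodMk hS)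
  rw [integral_comp_eq_sum_of_fintype P hX fun p => g (p.1, p.2.1) / π p.1 p.2.2]
  simp only [Fintype.sum_prod_type, Finset.mul_sum]
  refine Finset.sum_congr rfl fun c _ => Finset.sum_congr rfl fun y _ =>
    Finset.sum_congr rfl fun s _ => ?_
  have hset : {ω | (C ω, Y ω, S ω) = (c, y, s)} = {ω | Y ω = y ∧ C ω = c ∧ S ω = s} := by
    ext ω
    simp only [Set.mem_ofPred_eq, Prod.mk.injEq]
    tauto
  have hcs : (P {ω | C ω = c ∧ S ω = s}).toReal ≠ 0 :=
    (ENNReal.toReal_pos (hpos c s).ne' (measure_ne_top _ _)).ne'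
  have hs : (P {ω | S ω = s}).toReal ≠ 0 :=
    (ENNReal.toReal_pos ((hpos c s).trans_le (measure_mono fun _ h => h.2)).ne'
      (measure_ne_top _ _)).ne'
  rw [hset, hπ]
  field_simp
end

section
/- (Structural validity of backdoor adjustment on S.) Let (Ω, P) be a probability space with random variables C : Ω → 𝒞, S : Ω → 𝒮 (𝒞, 𝒮 finite types) and ε : Ω → E (E a measurable space) such that the pair (C, S) is independent of ε. Let 𝒴 be a finite type, g : 𝒞 × 𝒮 × E → 𝒴 measurable, and Y = g(C, S, ε). Fix c ∈ 𝒞 and assume P(C = c, S = s) > 0 for every s with P(S = s) > 0. Then for every y ∈ 𝒴: Σ_{s : P(S=s)>0} P(Y = y | C = c, S = s) · P(S = s) = P( g(c, S, ε) = y ). -/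
open MeasureTheory ProbabilityTheory

/-- Decomposition of a probability along the fibres of a random variable with values in a
finite type. -/
theorem measureReal_eq_sum_inter_fiber {Ω α : Type*} [MeasurableSpace Ω] (μ : Measure Ω)
    [IsFiniteMeasure μ] [Fintype α] [MeasurableSpace α] [MeasurableSingletonClass α]
    {X : Ω → α} (hX : Measurable X) {A : Set Ω} (hA : MeasurableSet A) :
    μ.real A = ∑ x, μ.real (X ⁻¹' {x} ∩ A) := by
  rw [← measureReal_biUnion_finset]
  · congr 1
    ext ω
    simp
  · intro i _ j _ hij
    exact Set.disjoint_left.2 fun ω hi hj => hij (hi.1.symm.trans hj.1)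
  · exact fun x _ => (hX (measurableSet_singleton x)).inter hA

/-- The product rule for real-valued probabilities of preimages under independent variables. -/
theorem ProbabilityTheory.IndepFun.measureReal_inter_preimage_eq_mul {Ω α β : Type*} [MeasurableSpace Ω]
    {μ : Measure Ω} [MeasurableSpace α] [MeasurableSpace β] {X : Ω → α} {Z : Ω → β}
    (h : IndepFun X Z μ) {A : Set α} {B : Set β} (hA : MeasurableSet A) (hB : MeasurableSet B) :
    μ.real (X ⁻¹' A ∩ Z ⁻¹' B) = μ.real (X ⁻¹' A) * μ.real (Z ⁻¹' B) := by
  simp only [measureReal_def, h.measure_inter_preimage_eq_mul A B hA hB, ENNReal.toReal_mul]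

/-- Structural validity of backdoor adjustment on `S`: if `(C, S)` is independent of the
exogenous noise `ε` and `Y = g(C, S, ε)`, then under positivity of `P(C = c, S = s)` for
all `s` with `P(S = s) > 0`, the backdoor adjustment formula
`∑_{s : P(S=s)>0} P(Y = y ∣ C = c, S = s) · P(S = s)` equals the post-intervention
probability `P(g(c, S, ε) = y)`. -/
theorem stmt6 {Ω : Type*} [MeasurableSpace Ω] (P : Measure Ω) [IsProbabilityMeasure P]
    {𝒞 𝒮 𝒴 : Type*} [Fintype 𝒞] [Fintype 𝒮] [Fintype 𝒴]
    [MeasurableSpace 𝒞] [MeasurableSingletonClass 𝒞]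
    [MeasurableSpace 𝒮] [MeasurableSingletonClass 𝒮]
    [MeasurableSpace 𝒴] [MeasurableSingletonClass 𝒴]
    {E : Type*} [MeasurableSpace E]
    (C : Ω → 𝒞) (S : Ω → 𝒮) (ε : Ω → E)
    (hC : Measurable C) (hS : Measurable S) (hε : Measurable ε)
    (hindep : IndepFun (fun ω => (C ω, S ω)) ε P)
    (g : 𝒞 × 𝒮 × E → 𝒴) (hg : Measurable g)
    (Y : Ω → 𝒴) (hY : ∀ ω, Y ω = g (C ω, S ω, ε ω))
    (c : 𝒞)
    (hpos : ∀ s : 𝒮, 0 < P {ω | S ω = s} → 0 < P {ω | C ω = c ∧ S ω = s})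
    (y : 𝒴) :
    ∑ s ∈ Finset.univ.filter (fun s : 𝒮 => 0 < P {ω | S ω = s}),
        ((P {ω | Y ω = y ∧ C ω = c ∧ S ω = s}).toReal
            / (P {ω | C ω = c ∧ S ω = s}).toReal)
          * (P {ω | S ω = s}).toReal
      = (P {ω | g (c, S ω, ε ω) = y}).toReal := by
  have hB (s : 𝒮) : MeasurableSet {e | g (c, s, e) = y} :=
    (hg.comp (measurable_const.prodMk (measurable_const.prodMk measurable_id)))
      (measurableSet_singleton y)
  have hA : MeasurableSet {ω | g (c, S ω, ε ω) = y} :=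
    (hg.comp (measurable_const.prodMk (hS.prodMk hε))) (measurableSet_singleton y)
  have hSε : IndepFun S ε P := hindep.comp measurable_snd measurable_id
  have hfiber (s : 𝒮) : S ⁻¹' {s} ∩ {ω | g (c, S ω, ε ω) = y}
      = S ⁻¹' {s} ∩ ε ⁻¹' {e | g (c, s, e) = y} := by
    ext ω
    simp +contextual
  have hcs (s : 𝒮) : {ω | C ω = c ∧ S ω = s} = (fun ω => (C ω, S ω)) ⁻¹' {(c, s)} := by
    ext ω
    simp
  have hycs (s : 𝒮) : {ω | Y ω = y ∧ C ω = c ∧ S ω = s}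
      = (fun ω => (C ω, S ω)) ⁻¹' {(c, s)} ∩ ε ⁻¹' {e | g (c, s, e) = y} := by
    ext ω
    simp only [hY, Set.mem_ofPred_eq, Set.mem_inter_iff, Set.mem_preimage,
      Set.mem_singleton_iff, Prod.mk.injEq]
    constructor
    · rintro ⟨h, rfl, rfl⟩
      exact ⟨⟨rfl, rfl⟩, h⟩
    · rintro ⟨⟨rfl, rfl⟩, h⟩
      exact ⟨h, rfl, rfl⟩
  simp only [← measureReal_def]
  rw [measureReal_eq_sum_inter_fiber P hS hA, Finset.sum_filter]
  refine Finset.sum_congr rfl fun s _ => ?_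
  rw [hfiber, hSε.measureReal_inter_preimage_eq_mul (measurableSet_singleton s) (hB s)]
  change _ = P.real {ω | S ω = s} * _
  split_ifs with hs
  · have hne : P.real {ω | C ω = c ∧ S ω = s} ≠ 0 :=
      (ENNReal.toReal_pos (hpos s hs).ne' (measure_ne_top P _)).ne'
    rw [hcs] at hne
    rw [hycs, hcs, hindep.measureReal_inter_preimage_eq_mul
      (measurableSet_singleton _) (hB s), mul_div_cancel_left₀ _ hne, mul_comm]
  · have hzero : P {ω | S ω = s} = 0 := by simpa using hs
    simp [measureReal_def, hzero]
end
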